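/- Lemma D.1, uniqueness part: In the setting of the minimization part, suppose moreover that the measurable score function s : X → ℝ^K has finite LSEL value, (1/K) Σ_k ∫ p_k log(1 + Σ_{l≠k} exp(s_l − s_k)) dμ < ∞, and that there exist k, l ∈ [K] such that the set { x ∈ X : p_k(x) > 0 and s_k(x) − s_l(x) ≠ log(p_k(x)/p_l(x)) } has strictly positive μ-measure. Then the inequality is strict: (1/K) Σ_k ∫_{{p_k>0}} p_k(x) log( (Σ_l p_l(x))/p_k(x) ) dμ(x) < (1/K) Σ_k ∫ p_k(x) log( 1 + Σ_{l≠k} exp(s_l(x) − s_k(x)) ) dμ(x). Hence the true LLR matrix is the unique (μ-a.e.) minimizer of the LSEL functional. -/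

import Mathlib

open Finset MeasureTheory
open scoped ENNReal

/-- The softmax cross-entropy term, written with the scores: it is `log` of the inverse softmax
probability `exp (s k) / ∑ l, exp (s l)`. -/
lemma one_add_sum_exp_sub {ι : Type*} [Fintype ι] [DecidableEq ι] (s : ι → ℝ) (k : ι) :
    1 + ∑ l ∈ univ.filter (· ≠ k), Real.exp (s l - s k) =
      (∑ l, Real.exp (s l)) / Real.exp (s k) := by
  rw [Finset.filter_ne', Finset.sum_div, ← Finset.add_sum_erase univ _ (mem_univ k),
    div_self (Real.exp_pos _).ne']
  simp only [Real.exp_sub]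

/-- Tangent-line bound behind Gibbs' inequality, for unnormalized weights. -/
lemma mul_log_div_le {a P q : ℝ} (ha : 0 < a) (hP : 0 < P) (hq : 0 < q) :
    a * Real.log (P / a) ≤ a * Real.log q⁻¹ + (P * q - a) := by
  have hsplit : Real.log (P / a) = Real.log q⁻¹ + Real.log (P * q / a) := by
    rw [← Real.log_mul (by positivity) (by positivity)]
    congr 1
    field_simp
  have h := mul_le_mul_of_nonneg_left
    (Real.log_le_sub_one_of_pos (show 0 < P * q / a by positivity)) ha.le
  have e : a * (P * q / a - 1) = P * q - a := by field_simp
  rw [hsplit, mul_add]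
  linarith

lemma mul_log_div_lt {a P q : ℝ} (ha : 0 < a) (hP : 0 < P) (hq : 0 < q) (hne : P * q ≠ a) :
    a * Real.log (P / a) < a * Real.log q⁻¹ + (P * q - a) := by
  have hsplit : Real.log (P / a) = Real.log q⁻¹ + Real.log (P * q / a) := by
    rw [← Real.log_mul (by positivity) (by positivity)]
    congr 1
    field_simp
  have h := mul_lt_mul_of_pos_left
    (Real.log_lt_sub_one_of_pos (show 0 < P * q / a by positivity)
      (fun h => hne ((div_eq_one_iff_eq ha.ne').1 h))) ha
  have e : a * (P * q / a - 1) = P * q - a := by field_simp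
  rw [hsplit, mul_add]
  linarith

lemma sum_mul_softmax_sub_eq_zero {ι : Type*} [Fintype ι] [Nonempty ι] (p s : ι → ℝ) :
    ∑ k, ((∑ l, p l) * (Real.exp (s k) / ∑ l, Real.exp (s l)) - p k) = 0 := by
  have hS : 0 < ∑ l, Real.exp (s l) := Finset.sum_pos (fun _ _ => Real.exp_pos _) univ_nonempty
  rw [Finset.sum_sub_distrib, ← Finset.mul_sum, ← Finset.sum_div, div_self hS.ne', mul_one,
    sub_self]

lemma sum_mul_log_le_softmax {ι : Type*} [Fintype ι] [Nonempty ι] [DecidableEq ι]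
    (p s : ι → ℝ) (hp : ∀ k, 0 < p k) :
    ∑ k, p k * Real.log ((∑ l, p l) / p k) ≤
      ∑ k, p k * Real.log (1 + ∑ l ∈ univ.filter (· ≠ k), Real.exp (s l - s k)) := by
  have hP : 0 < ∑ l, p l := Finset.sum_pos (fun l _ => hp l) univ_nonempty
  have hS : 0 < ∑ l, Real.exp (s l) := Finset.sum_pos (fun _ _ => Real.exp_pos _) univ_nonempty
  have h := Finset.sum_le_sum fun k (_ : k ∈ univ) =>
    mul_log_div_le (hp k) hP (div_pos (Real.exp_pos (s k)) hS)
  rw [Finset.sum_add_distrib, sum_mul_softmax_sub_eq_zero, add_zero] at h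
  simpa only [one_add_sum_exp_sub, inv_div] using h

lemma sum_mul_log_lt_softmax {ι : Type*} [Fintype ι] [Nonempty ι] [DecidableEq ι]
    (p s : ι → ℝ) (hp : ∀ k, 0 < p k)
    (hne : ∃ k l, s k - s l ≠ Real.log (p k / p l)) :
    ∑ k, p k * Real.log ((∑ l, p l) / p k) <
      ∑ k, p k * Real.log (1 + ∑ l ∈ univ.filter (· ≠ k), Real.exp (s l - s k)) := by
  have hP : 0 < ∑ l, p l := Finset.sum_pos (fun l _ => hp l) univ_nonempty
  have hS : 0 < ∑ l, Real.exp (s l) := Finset.sum_pos (fun _ _ => Real.exp_pos _) univ_nonempty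
  have hq (k : ι) : 0 < Real.exp (s k) / ∑ l, Real.exp (s l) := div_pos (Real.exp_pos _) hS
  have hj : ∃ j, (∑ l, p l) * (Real.exp (s j) / ∑ l, Real.exp (s l)) ≠ p j := by
    by_contra! hall
    obtain ⟨k, l, hkl⟩ := hne
    apply hkl
    rw [← hall k, ← hall l, mul_div_mul_left _ _ hP.ne', div_div_div_cancel_right₀ hS.ne',
      ← Real.exp_sub, Real.log_exp]
  obtain ⟨j, hj⟩ := hj
  have h := Finset.sum_lt_sum (fun k (_ : k ∈ univ) => mul_log_div_le (hp k) hP (hq k))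
    ⟨j, mem_univ j, mul_log_div_lt (hp j) hP (hq j) hj⟩
  rw [Finset.sum_add_distrib, sum_mul_softmax_sub_eq_zero, add_zero] at h
  simpa only [one_add_sum_exp_sub, inv_div] using h

/-- Lemma D.1, uniqueness part: the true LLR matrix is the unique (μ-a.e.)
minimizer of the LSEL functional. -/
theorem lsel_nonparametric_uniqueness {X : Type*} [MeasurableSpace X]
    (μ : Measure X) (K : ℕ) (hK : 2 ≤ K)
    (p : Fin K → X → ℝ)
    (hmeas : ∀ k, Measurable (p k)) (hnn : ∀ k x, 0 ≤ p k x)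
    (hprob : ∀ k, ∫⁻ x, ENNReal.ofReal (p k x) ∂μ = 1)
    (hsupp : ∀ k l x, p k x = 0 ↔ p l x = 0)
    (s : X → Fin K → ℝ) (hs : Measurable s)
    (hfin :
      ((K : ℝ≥0∞))⁻¹ *
        ∑ k, ∫⁻ x,
          ENNReal.ofReal (p k x *
            Real.log (1 + ∑ l ∈ univ.filter (· ≠ k), Real.exp (s x l - s x k))) ∂μ ≠ ⊤)
    (hdiff : ∃ k l : Fin K,
      0 < μ {x | 0 < p k x ∧ s x k - s x l ≠ Real.log (p k x / p l x)}) :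
    ((K : ℝ≥0∞))⁻¹ *
        ∑ k, ∫⁻ x in {x | 0 < p k x},
          ENNReal.ofReal (p k x * Real.log ((∑ l, p l x) / p k x)) ∂μ <
      ((K : ℝ≥0∞))⁻¹ *
        ∑ k, ∫⁻ x,
          ENNReal.ofReal (p k x *
            Real.log (1 + ∑ l ∈ univ.filter (· ≠ k), Real.exp (s x l - s x k))) ∂μ := by
  have : NeZero K := ⟨by omega⟩
  have hKtop : ((K : ℝ≥0∞))⁻¹ ≠ ⊤ := by simp; omega
  have hK0 : ((K : ℝ≥0∞))⁻¹ ≠ 0 := by simp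
  have hs' (l : Fin K) : Measurable fun x => s x l := (measurable_pi_apply l).comp hs
  set f : Fin K → X → ℝ := fun k x => p k x * Real.log ((∑ l, p l x) / p k x) with hf
  set g : Fin K → X → ℝ := fun k x =>
    p k x * Real.log (1 + ∑ l ∈ univ.filter (· ≠ k), Real.exp (s x l - s x k)) with hg
  have hfm (k : Fin K) : Measurable (f k) :=
    (hmeas k).mul
      (((Finset.measurable_fun_sum univ fun l _ => hmeas l).div (hmeas k)).log)
  have hgm (k : Fin K) : Measurable (g k) :=
    (hmeas k).mul (measurable_const.add (Finset.measurable_fun_sum _ fun l _ =>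
      ((hs' l).sub (hs' k)).exp)).log
  have hf0 (k : Fin K) (x : X) : 0 ≤ f k x := by
    rcases (hnn k x).eq_or_lt with h | h
    · simp [hf, ← h]
    · exact mul_nonneg h.le (Real.log_nonneg ((one_le_div h).2
        (Finset.single_le_sum (f := fun l => p l x) (fun l _ => hnn l x) (mem_univ k))))
  have hg0 (k : Fin K) (x : X) : 0 ≤ g k x :=
    mul_nonneg (hnn k x) (Real.log_nonneg (le_add_of_nonneg_right
      (Finset.sum_nonneg fun _ _ => (Real.exp_pos _).le)))
  have hpos {k : Fin K} {x : X} (h : 0 < p k x) (l : Fin K) : 0 < p l x :=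
    (hnn l x).lt_of_ne' fun hl => h.ne' ((hsupp l k x).1 hl)
  have hle (x : X) : ∑ k, f k x ≤ ∑ k, g k x := by
    rcases (hnn 0 x).eq_or_lt with h | h
    · have hz (k : Fin K) : p k x = 0 := (hsupp 0 k x).1 h.symm
      simp [hf, hg, hz]
    · exact sum_mul_log_le_softmax (fun k => p k x) (s x) (hpos h)
  have hint {u : Fin K → X → ℝ} (hu : ∀ k, Measurable (u k)) (hu0 : ∀ k x, 0 ≤ u k x) :
      ∑ k, ∫⁻ x, ENNReal.ofReal (u k x) ∂μ = ∫⁻ x, ENNReal.ofReal (∑ k, u k x) ∂μ := by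
    rw [← lintegral_finsetSum _ fun k _ => (hu k).ennreal_ofReal]
    simp only [ENNReal.ofReal_sum_of_nonneg fun k _ => hu0 k _]
  have hGfin : ∫⁻ x, ENNReal.ofReal (∑ k, g k x) ∂μ ≠ ⊤ := by
    rw [← hint hgm hg0]
    intro h
    exact hfin (by rw [h, ENNReal.mul_top hK0])
  obtain ⟨k, l, hkl⟩ := hdiff
  refine (ENNReal.mul_lt_mul_iff_right hK0 hKtop).2 ?_
  calc ∑ k, ∫⁻ x in {x | 0 < p k x}, ENNReal.ofReal (f k x) ∂μ
      ≤ ∑ k, ∫⁻ x, ENNReal.ofReal (f k x) ∂μ :=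
        Finset.sum_le_sum fun _ _ => setLIntegral_le_lintegral _ _
    _ = ∫⁻ x, ENNReal.ofReal (∑ k, f k x) ∂μ := hint hfm hf0
    _ < ∫⁻ x, ENNReal.ofReal (∑ k, g k x) ∂μ := by
        refine lintegral_strict_mono_of_ae_le_of_ae_lt_on
          (Finset.measurable_fun_sum univ fun k _ => hgm k).ennreal_ofReal.aemeasurable
          (ne_top_of_le_ne_top hGfin (lintegral_mono fun x => ENNReal.ofReal_le_ofReal (hle x)))
          (ae_of_all _ fun x => ENNReal.ofReal_le_ofReal (hle x)) hkl.ne'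
          (ae_of_all _ fun x hx => ?_)
        have hlt := sum_mul_log_lt_softmax (fun k => p k x) (s x) (hpos hx.1) ⟨k, l, hx.2⟩
        exact (ENNReal.ofReal_lt_ofReal_iff
          ((Finset.sum_nonneg fun k _ => hf0 k x).trans_lt hlt)).2 hlt
    _ = ∑ k, ∫⁻ x, ENNReal.ofReal (g k x) ∂μ := (hint hgm hg0).symm
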